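/- Let N ≥ 2, let m_1,…,m_N > 0 with M := Σ_{i=1}^N m_i, and let q = (q_1,…,q_N) be a candidate solution of the curved N-body problem in S³ of positive elliptic-elliptic form, with 0 < r_i(t) < 1 for all i, t and q_ij(t)² ≠ 1 for i ≠ j. Then q solves the equations of motion in S³ if and only if there exist constants c_1, c_2 such that α̇ = c_1/(Σ_{i=1}^N m_i r_i²), β̇ = c_2/(M − Σ_{i=1}^N m_i r_i²), and for every i = 1,…,N and every t: (1) r̈_i = r_i(1 − r_i²)(α̇² − β̇²) − r_i ṙ_i²/(1 − r_i²) + Σ_{j≠i} m_j [r_j(1 − r_i²) cos(a_i − a_j) − r_i (1 − r_i²)^{1/2} (1 − r_j²)^{1/2} cos(b_i − b_j)]/(1 − q_ij²)^{3/2}; (2) r_i α̈ + 2 ṙ_i α̇ = Σ_{j≠i} m_j r_j sin(a_j − a_i)/(1 − q_ij²)^{3/2}; (3) ρ_i β̈ + 2 ρ̇_i β̇ = Σ_{j≠i} m_j ρ_j sin(b_j − b_i)/(1 − q_ij²)^{3/2}, where ρ_i := (1 − r_i²)^{1/2}. -/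

import Mathlib

open Real Finset

section PolarCoordinates

variable {r φ : ℝ → ℝ}

theorem hasDerivAt_deriv_of_contDiff_two (hr : ContDiff ℝ 2 r) (t : ℝ) :
    HasDerivAt (deriv r) (deriv (deriv r) t) t := by
  have h : ContDiff ℝ (1 + 1) r := by rw [one_add_one_eq_two]; exact hr
  exact ((contDiff_succ_iff_deriv.1 h).2.2.differentiable one_ne_zero t).hasDerivAt

theorem hasDerivAt_of_contDiff_two (hr : ContDiff ℝ 2 r) (t : ℝ) :
    HasDerivAt r (deriv r t) t :=
  (hr.differentiable two_ne_zero t).hasDerivAt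

theorem deriv_mul_cos_add (hr : ContDiff ℝ 2 r) (hφ : ContDiff ℝ 2 φ) (c : ℝ) :
    deriv (fun t => r t * cos (φ t + c)) =
      fun t => deriv r t * cos (φ t + c) - r t * deriv φ t * sin (φ t + c) := by
  funext t
  refine ((hasDerivAt_of_contDiff_two hr t).mul
    ((hasDerivAt_of_contDiff_two hφ t).add_const c).cos).deriv.trans ?_
  ring

theorem deriv_mul_sin_add (hr : ContDiff ℝ 2 r) (hφ : ContDiff ℝ 2 φ) (c : ℝ) :
    deriv (fun t => r t * sin (φ t + c)) =
      fun t => deriv r t * sin (φ t + c) + r t * deriv φ t * cos (φ t + c) := by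
  funext t
  refine ((hasDerivAt_of_contDiff_two hr t).mul
    ((hasDerivAt_of_contDiff_two hφ t).add_const c).sin).deriv.trans ?_
  ring

theorem deriv_deriv_mul_cos_add (hr : ContDiff ℝ 2 r) (hφ : ContDiff ℝ 2 φ) (c t : ℝ) :
    deriv (deriv fun t => r t * cos (φ t + c)) t =
      (deriv (deriv r) t - r t * deriv φ t ^ 2) * cos (φ t + c)
        - (r t * deriv (deriv φ) t + 2 * deriv r t * deriv φ t) * sin (φ t + c) := by
  rw [deriv_mul_cos_add hr hφ]
  have h1 := (hasDerivAt_of_contDiff_two hφ t).add_const c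
  refine (((hasDerivAt_deriv_of_contDiff_two hr t).mul h1.cos).sub
    (((hasDerivAt_of_contDiff_two hr t).mul
      (hasDerivAt_deriv_of_contDiff_two hφ t)).mul h1.sin)).deriv.trans ?_
  simp only [Pi.mul_apply]
  ring

theorem deriv_deriv_mul_sin_add (hr : ContDiff ℝ 2 r) (hφ : ContDiff ℝ 2 φ) (c t : ℝ) :
    deriv (deriv fun t => r t * sin (φ t + c)) t =
      (deriv (deriv r) t - r t * deriv φ t ^ 2) * sin (φ t + c)
        + (r t * deriv (deriv φ) t + 2 * deriv r t * deriv φ t) * cos (φ t + c) := by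
  rw [deriv_mul_sin_add hr hφ]
  have h1 := (hasDerivAt_of_contDiff_two hφ t).add_const c
  refine (((hasDerivAt_deriv_of_contDiff_two hr t).mul h1.sin).add
    (((hasDerivAt_of_contDiff_two hr t).mul
      (hasDerivAt_deriv_of_contDiff_two hφ t)).mul h1.cos)).deriv.trans ?_
  simp only [Pi.mul_apply]
  ring

theorem deriv_sq_add_deriv_sq_polar (hr : ContDiff ℝ 2 r) (hφ : ContDiff ℝ 2 φ) (c t : ℝ) :
    deriv (fun t => r t * cos (φ t + c)) t ^ 2 + deriv (fun t => r t * sin (φ t + c)) t ^ 2 =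
      deriv r t ^ 2 + r t ^ 2 * deriv φ t ^ 2 := by
  rw [deriv_mul_cos_add hr hφ, deriv_mul_sin_add hr hφ]
  linear_combination (deriv r t ^ 2 + r t ^ 2 * deriv φ t ^ 2) * sin_sq_add_cos_sq (φ t + c)

theorem rotation_eq_iff (θ P Q A B : ℝ) :
    (P * cos θ - Q * sin θ = A * cos θ - B * sin θ ∧
      P * sin θ + Q * cos θ = A * sin θ + B * cos θ) ↔ P = A ∧ Q = B := by
  have h := sin_sq_add_cos_sq θ
  refine ⟨fun ⟨h1, h2⟩ => ⟨?_, ?_⟩, fun ⟨h1, h2⟩ => by rw [h1, h2]; exact ⟨rfl, rfl⟩⟩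
  · linear_combination cos θ * h1 + sin θ * h2 + (A - P) * h
  · linear_combination cos θ * h2 - sin θ * h1 + (B - Q) * h

/-- The two Cartesian components of a planar equation of motion are equivalent to its radial and
tangential components. -/
theorem polar_equations_iff {ι : Type*} (s : Finset ι) (hr : ContDiff ℝ 2 r)
    (hφ : ContDiff ℝ 2 φ) (m R C κ D : ι → ℝ) (c v t : ℝ) :
    (deriv (deriv fun t => r t * cos (φ t + c)) t =
        (∑ j ∈ s, m j * (R j * cos (φ t + C j) - κ j * (r t * cos (φ t + c))) / D j)
          - v * (r t * cos (φ t + c)) ∧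
      deriv (deriv fun t => r t * sin (φ t + c)) t =
        (∑ j ∈ s, m j * (R j * sin (φ t + C j) - κ j * (r t * sin (φ t + c))) / D j)
          - v * (r t * sin (φ t + c))) ↔
    (deriv (deriv r) t - r t * deriv φ t ^ 2 =
        (∑ j ∈ s, m j * (R j * cos (c - C j) - κ j * r t) / D j) - v * r t ∧
      r t * deriv (deriv φ) t + 2 * deriv r t * deriv φ t =
        ∑ j ∈ s, m j * R j * sin (C j - c) / D j) := by
  rw [deriv_deriv_mul_cos_add hr hφ, deriv_deriv_mul_sin_add hr hφ]
  have hangle (j : ι) : φ t + C j = (φ t + c) + (C j - c) := by ring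
  have hflip (j : ι) : cos (c - C j) = cos (C j - c) := by rw [← cos_neg, neg_sub]
  have hcos : (∑ j ∈ s, m j * (R j * cos (φ t + C j) - κ j * (r t * cos (φ t + c))) / D j)
          - v * (r t * cos (φ t + c)) =
      ((∑ j ∈ s, m j * (R j * cos (c - C j) - κ j * r t) / D j) - v * r t) * cos (φ t + c)
        - (∑ j ∈ s, m j * R j * sin (C j - c) / D j) * sin (φ t + c) := by
    rw [sub_mul, sub_right_comm, sum_mul, sum_mul, ← sum_sub_distrib, mul_assoc]
    congr 1
    refine sum_congr rfl fun j _ => ?_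
    rw [hangle j, cos_add, hflip]
    ring
  have hsin : (∑ j ∈ s, m j * (R j * sin (φ t + C j) - κ j * (r t * sin (φ t + c))) / D j)
          - v * (r t * sin (φ t + c)) =
      ((∑ j ∈ s, m j * (R j * cos (c - C j) - κ j * r t) / D j) - v * r t) * sin (φ t + c)
        + (∑ j ∈ s, m j * R j * sin (C j - c) / D j) * cos (φ t + c) := by
    rw [sub_mul, sub_add_eq_add_sub, sum_mul, sum_mul, ← sum_add_distrib, mul_assoc]
    congr 1
    refine sum_congr rfl fun j _ => ?_
    rw [hangle j, sin_add, hflip]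
    ring
  rw [hcos, hsin, rotation_eq_iff]

end PolarCoordinates

theorem sum_sum_erase_eq_zero_of_antisymm {ι : Type*} [Fintype ι] [DecidableEq ι]
    (f : ι → ι → ℝ) (hf : ∀ i j, f i j = -f j i) :
    ∑ i, ∑ j ∈ univ.erase i, f i j = 0 := by
  have herase (i : ι) : ∑ j ∈ univ.erase i, f i j = ∑ j, f i j :=
    sum_erase _ (by linarith [hf i i])
  simp only [herase]
  have h : ∑ i, ∑ j, f i j = -∑ i, ∑ j, f i j := by
    conv_lhs => rw [sum_comm]
    simp only [← sum_neg_distrib]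
    exact sum_congr rfl fun i _ => sum_congr rfl fun j _ => hf j i
  linarith

/-- Conservation of angular momentum: the tangential equations force `deriv φ` to be a constant
divided by the moment of inertia. -/
theorem exists_deriv_eq_div_of_tangential {ι : Type*} [Fintype ι] [DecidableEq ι]
    {φ : ℝ → ℝ} {r : ι → ℝ → ℝ} (hφ : ContDiff ℝ 2 φ) (hr : ∀ i, ContDiff ℝ 2 (r i))
    (m a : ι → ℝ) (D : ι → ι → ℝ → ℝ) (hD : ∀ i j t, D i j t = D j i t)
    (hI : ∀ t, ∑ i, m i * r i t ^ 2 ≠ 0)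
    (h : ∀ i t, r i t * deriv (deriv φ) t + 2 * deriv (r i) t * deriv φ t =
      ∑ j ∈ univ.erase i, m j * r j t * sin (a j - a i) / D i j t) :
    ∃ c : ℝ, ∀ t, deriv φ t = c / ∑ i, m i * r i t ^ 2 := by
  have hderiv (t : ℝ) :
      HasDerivAt (fun t => ∑ i, m i * (r i t ^ 2 * deriv φ t)) 0 t := by
    have hsum := HasDerivAt.fun_sum (u := univ) fun i _ =>
      (((hasDerivAt_of_contDiff_two (hr i) t).pow 2).mul
        (hasDerivAt_deriv_of_contDiff_two hφ t)).const_mul (m i)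
    refine hsum.congr_deriv ?_
    rw [← sum_sum_erase_eq_zero_of_antisymm
      (fun i j => m i * r i t * (m j * r j t * sin (a j - a i) / D i j t)) fun i j => by
        rw [hD j i, ← neg_sub (a j) (a i), sin_neg]; ring]
    refine sum_congr rfl fun i _ => ?_
    rw [← mul_sum, ← h i t]
    simp only [Pi.pow_apply]
    push_cast
    ring
  refine ⟨∑ i, m i * (r i 0 ^ 2 * deriv φ 0), fun t => ?_⟩
  rw [eq_div_iff (hI t), mul_sum]
  refine Eq.trans ?_ (is_const_of_deriv_eq_zero (fun t => (hderiv t).differentiableAt)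
    (fun t => (hderiv t).deriv) t 0)
  exact sum_congr rfl fun i _ => by ring

/-- For a point on the sphere written in two polar planes of radii `r` and `ρ`, the radial equation
in the plane of radius `ρ` follows from the one in the plane of radius `r`, which can be rewritten
without `ρ` and its derivatives. -/
theorem radial_equations_iff {ι : Type*} (s : Finset ι) (m R S C E κ D : ι → ℝ)
    {r r₁ r₂ ρ ρ₁ ρ₂ A B v : ℝ} (hρpos : 0 < ρ) (hρ : ρ ^ 2 = 1 - r ^ 2)
    (h₁ : r * r₁ + ρ * ρ₁ = 0) (h₂ : r * r₂ + r₁ ^ 2 + (ρ * ρ₂ + ρ₁ ^ 2) = 0)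
    (hv : v = r₁ ^ 2 + r ^ 2 * A ^ 2 + (ρ₁ ^ 2 + ρ ^ 2 * B ^ 2))
    (hκ : ∀ j, κ j = r * R j * C j + ρ * S j * E j) :
    (r₂ - r * A ^ 2 = (∑ j ∈ s, m j * (R j * C j - κ j * r) / D j) - v * r ∧
      ρ₂ - ρ * B ^ 2 = (∑ j ∈ s, m j * (S j * E j - κ j * ρ) / D j) - v * ρ) ↔
    r₂ = r * (1 - r ^ 2) * (A ^ 2 - B ^ 2) - r * r₁ ^ 2 / (1 - r ^ 2)
      + ∑ j ∈ s, m j * (R j * (1 - r ^ 2) * C j - r * ρ * S j * E j) / D j := by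
  have hsum : ∑ j ∈ s, m j * (R j * (1 - r ^ 2) * C j - r * ρ * S j * E j) / D j =
      ∑ j ∈ s, m j * (R j * C j - κ j * r) / D j :=
    sum_congr rfl fun j _ => by rw [hκ]; ring
  have hbalance : r * (∑ j ∈ s, m j * (R j * C j - κ j * r) / D j) +
      ρ * (∑ j ∈ s, m j * (S j * E j - κ j * ρ) / D j) = 0 := by
    rw [mul_sum, mul_sum, ← sum_add_distrib]
    refine sum_eq_zero fun j _ => ?_
    linear_combination -(m j / D j) * hκ j - m j / D j * κ j * hρ
  have hspeed : r * r₁ ^ 2 / (1 - r ^ 2) = r * (r₁ ^ 2 + ρ₁ ^ 2) := by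
    rw [← hρ, div_eq_iff (by positivity)]
    linear_combination r * r₁ ^ 2 * (-hρ) + r * (r * r₁ - ρ * ρ₁) * h₁
  rw [hsum, hspeed]
  generalize ∑ j ∈ s, m j * (R j * C j - κ j * r) / D j = X at *
  generalize ∑ j ∈ s, m j * (S j * E j - κ j * ρ) / D j = W at *
  constructor
  · rintro ⟨h, -⟩
    linear_combination h - r * hv - r * B ^ 2 * hρ
  · intro h
    have hr : r₂ - r * A ^ 2 = X - v * r := by
      linear_combination h + r * hv + r * B ^ 2 * hρ
    refine ⟨hr, mul_left_cancel₀ hρpos.ne' ?_⟩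
    linear_combination h₂ - r * hr - hbalance + hv + v * hρ

/-- Criterion for positive elliptic-elliptic rotopulsators in S³. -/
theorem positive_elliptic_elliptic_criterion
    (N : ℕ) (hN : 2 ≤ N)
    (m a b : Fin N → ℝ) (hm : ∀ i, 0 < m i)
    (α β : ℝ → ℝ) (r ρ w x Y Z : Fin N → ℝ → ℝ)
    (hαC : ContDiff ℝ 2 α) (hβC : ContDiff ℝ 2 β)
    (hrC : ∀ i, ContDiff ℝ 2 (r i))
    (hρ : ∀ i t, ρ i t = Real.sqrt (1 - r i t ^ 2))
    (hw : ∀ i t, w i t = r i t * cos (α t + a i))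
    (hx : ∀ i t, x i t = r i t * sin (α t + a i))
    (hY : ∀ i t, Y i t = ρ i t * cos (β t + b i))
    (hZ : ∀ i t, Z i t = ρ i t * sin (β t + b i))
    (hrpos : ∀ i t, 0 < r i t) (hrlt : ∀ i t, r i t < 1)
    (q : Fin N → Fin N → ℝ → ℝ)
    (hq : ∀ i j t, q i j t =
      w i t * w j t + x i t * x j t + Y i t * Y j t + Z i t * Z j t)
    (hreg : ∀ i j, i ≠ j → ∀ t, q i j t ^ 2 ≠ 1) :
    (∀ f : Fin N → ℝ → ℝ, (f = w ∨ f = x ∨ f = Y ∨ f = Z) → ∀ i t,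
        deriv (deriv (f i)) t =
          (∑ j ∈ Finset.univ.erase i,
            m j * (f j t - q i j t * f i t) / (1 - q i j t ^ 2) ^ ((3:ℝ)/2))
          - (deriv (w i) t ^ 2 + deriv (x i) t ^ 2 + deriv (Y i) t ^ 2
              + deriv (Z i) t ^ 2) * f i t)
    ↔
    (∃ c₁ c₂ : ℝ,
      (∀ t, deriv α t = c₁ / ∑ i, m i * r i t ^ 2) ∧
      (∀ t, deriv β t = c₂ / ((∑ i, m i) - ∑ i, m i * r i t ^ 2)) ∧
      (∀ i t,
        deriv (deriv (r i)) t =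
          r i t * (1 - r i t ^ 2) * (deriv α t ^ 2 - deriv β t ^ 2)
          - r i t * deriv (r i) t ^ 2 / (1 - r i t ^ 2)
          + ∑ j ∈ Finset.univ.erase i,
              m j * (r j t * (1 - r i t ^ 2) * cos (a i - a j)
                - r i t * Real.sqrt (1 - r i t ^ 2) * Real.sqrt (1 - r j t ^ 2)
                    * cos (b i - b j))
                / (1 - q i j t ^ 2) ^ ((3:ℝ)/2)) ∧
      (∀ i t,
        r i t * deriv (deriv α) t + 2 * deriv (r i) t * deriv α t =
          ∑ j ∈ Finset.univ.erase i,
            m j * r j t * sin (a j - a i) / (1 - q i j t ^ 2) ^ ((3:ℝ)/2)) ∧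
      (∀ i t,
        ρ i t * deriv (deriv β) t + 2 * deriv (ρ i) t * deriv β t =
          ∑ j ∈ Finset.univ.erase i,
            m j * ρ j t * sin (b j - b i) / (1 - q i j t ^ 2) ^ ((3:ℝ)/2))) := by
  have hspos (i t) : 0 < 1 - r i t ^ 2 := by nlinarith [hrpos i t, hrlt i t]
  have hρpos (i t) : 0 < ρ i t := by rw [hρ]; exact sqrt_pos.2 (hspos i t)
  have hρsq (i t) : ρ i t ^ 2 = 1 - r i t ^ 2 := by rw [hρ, sq_sqrt (hspos i t).le]
  have hρC (i) : ContDiff ℝ 2 (ρ i) := by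
    rw [funext (hρ i)]
    exact (contDiff_const.sub ((hrC i).pow 2)).sqrt fun t => (hspos i t).ne'
  have hfirst (i t) : r i t * deriv (r i) t + ρ i t * deriv (ρ i) t = 0 := by
    have h := ((hasDerivAt_of_contDiff_two (hrC i) t).pow 2).add
      ((hasDerivAt_of_contDiff_two (hρC i) t).pow 2)
    have hone : r i ^ 2 + ρ i ^ 2 = fun _ => 1 := by
      funext t
      simp [hρsq]
    rw [hone] at h
    have := h.unique (hasDerivAt_const t 1)
    push_cast at this
    linear_combination this / 2
  have hsecond (i t) : r i t * deriv (deriv (r i)) t + deriv (r i) t ^ 2 +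
      (ρ i t * deriv (deriv (ρ i)) t + deriv (ρ i) t ^ 2) = 0 := by
    have h := ((hasDerivAt_of_contDiff_two (hrC i) t).mul
      (hasDerivAt_deriv_of_contDiff_two (hrC i) t)).add
      ((hasDerivAt_of_contDiff_two (hρC i) t).mul (hasDerivAt_deriv_of_contDiff_two (hρC i) t))
    have hzero : r i * deriv (r i) + ρ i * deriv (ρ i) = fun _ => 0 := funext (hfirst i)
    rw [hzero] at h
    linear_combination h.unique (hasDerivAt_const t 0)
  have hqpolar (i j t) : q i j t =
      r i t * r j t * cos (a i - a j) + ρ i t * ρ j t * cos (b i - b j) := by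
    rw [hq, hw, hw, hx, hx, hY, hY, hZ, hZ, ← add_sub_add_left_eq_sub (a i) (a j) (α t),
      ← add_sub_add_left_eq_sub (b i) (b j) (β t), cos_sub, cos_sub]
    ring
  have hqsymm (i j t) : q i j t = q j i t := by
    rw [hq, hq]
    ring
  have hspeed (i t) : deriv (w i) t ^ 2 + deriv (x i) t ^ 2 + deriv (Y i) t ^ 2
      + deriv (Z i) t ^ 2 = deriv (r i) t ^ 2 + r i t ^ 2 * deriv α t ^ 2
        + (deriv (ρ i) t ^ 2 + ρ i t ^ 2 * deriv β t ^ 2) := by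
    rw [← deriv_sq_add_deriv_sq_polar (hrC i) hαC (a i),
      ← deriv_sq_add_deriv_sq_polar (hρC i) hβC (b i), funext (hw i), funext (hx i),
      funext (hY i), funext (hZ i)]
    ring
  have hmotion (i t) := and_congr
    (polar_equations_iff (univ.erase i) (hrC i) hαC m (r · t) a (q i · t)
      (fun j => (1 - q i j t ^ 2) ^ ((3:ℝ)/2)) (a i)
      (deriv (w i) t ^ 2 + deriv (x i) t ^ 2 + deriv (Y i) t ^ 2 + deriv (Z i) t ^ 2) t)
    (polar_equations_iff (univ.erase i) (hρC i) hβC m (ρ · t) b (q i · t)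
      (fun j => (1 - q i j t ^ 2) ^ ((3:ℝ)/2)) (b i)
      (deriv (w i) t ^ 2 + deriv (x i) t ^ 2 + deriv (Y i) t ^ 2 + deriv (Z i) t ^ 2) t)
  have hradial (i t) := radial_equations_iff (univ.erase i) m (r · t) (ρ · t)
    (fun j => cos (a i - a j)) (fun j => cos (b i - b j)) (q i · t)
    (fun j => (1 - q i j t ^ 2) ^ ((3:ℝ)/2)) (hρpos i t) (hρsq i t) (hfirst i t) (hsecond i t)
    (hspeed i t) (fun j => hqpolar i j t)
  simp only [← hw, ← hx, ← hY, ← hZ] at hmotion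
  simp only [← hρ]
  constructor
  · intro h
    have hall (i t) := (hmotion i t).1
      ⟨⟨h w (.inl rfl) i t, h x (.inr (.inl rfl)) i t⟩,
        h Y (.inr (.inr (.inl rfl))) i t, h Z (.inr (.inr (.inr rfl))) i t⟩
    have hne : (univ : Finset (Fin N)).Nonempty := ⟨⟨0, by omega⟩, mem_univ _⟩
    obtain ⟨c₁, hc₁⟩ := exists_deriv_eq_div_of_tangential hαC hrC m a
      (fun i j t => (1 - q i j t ^ 2) ^ ((3:ℝ)/2)) (fun i j t => by rw [hqsymm])
      (fun t => (sum_pos (fun i _ => mul_pos (hm i) (pow_pos (hrpos i t) 2)) hne).ne')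
      fun i t => (hall i t).1.2
    obtain ⟨c₂, hc₂⟩ := exists_deriv_eq_div_of_tangential hβC hρC m b
      (fun i j t => (1 - q i j t ^ 2) ^ ((3:ℝ)/2)) (fun i j t => by rw [hqsymm])
      (fun t => (sum_pos (fun i _ => mul_pos (hm i) (pow_pos (hρpos i t) 2)) hne).ne')
      fun i t => (hall i t).2.2
    refine ⟨c₁, c₂, hc₁, fun t => ?_, fun i t => (hradial i t).1 ⟨(hall i t).1.1, (hall i t).2.1⟩,
      fun i t => (hall i t).1.2, fun i t => (hall i t).2.2⟩
    rw [hc₂, ← sum_sub_distrib]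
    simp only [hρsq, mul_sub, mul_one]
  · rintro ⟨-, -, -, -, h₁, h₂, h₃⟩ f hf i t
    have hrad := (hradial i t).2 (h₁ i t)
    obtain ⟨⟨ew, ex⟩, eY, eZ⟩ := (hmotion i t).2 ⟨⟨hrad.1, h₂ i t⟩, hrad.2, h₃ i t⟩
    rcases hf with rfl | rfl | rfl | rfl
    exacts [ew, ex, eY, eZ]
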